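/- Let B be an affine k-domain with a nontrivial fundamental pair (D,U) and induced ℤ-grading B = ⊕_{n∈ℤ} B_n. Then for every n ∈ ℤ, the restricted map D : B_n → B_{n+2} is injective if n ≤ −1 and surjective if n ≥ −1. -/

import Mathlib

/-- A derivation is locally nilpotent if every element is annihilated by some power. -/
def IsLND {R B : Type*} [CommRing R] [CommRing B] [Algebra R B]
    (D : Derivation R B B) : Prop :=
  ∀ b : B, ∃ n : ℕ, (D.toLinearMap ^ n) b = 0

/-- The degree-`d` piece `B_d = ker([D,U] - d·id)` of the `ℤ`-grading induced by `(D, U)`. -/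
def gradePiece {R B : Type*} [CommRing R] [CommRing B] [Algebra R B]
    (D U : Derivation R B B) (d : ℤ) : Submodule R B :=
  LinearMap.ker ((⁅D, U⁆ : Derivation R B B).toLinearMap
    - d • (LinearMap.id : B →ₗ[R] B))

/-- `(D, U)` is a fundamental pair: both are locally nilpotent, `[D,[D,U]] = -2D`,
`[U,[D,U]] = 2U`, and `B` is the sum of the eigenspaces of `[D,U]`. -/
def IsFundamentalPair {R B : Type*} [CommRing R] [CommRing B] [Algebra R B]
    (D U : Derivation R B B) : Prop :=
  IsLND D ∧ IsLND U ∧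
    ⁅D, ⁅D, U⁆⁆ = (-2 : ℤ) • D ∧
    ⁅U, ⁅D, U⁆⁆ = (2 : ℤ) • U ∧
    (⨆ d : ℤ, gradePiece D U d) = ⊤

section FundamentalPair

variable {R B : Type*} [CommRing R] [CommRing B] [Algebra R B] {D U : Derivation R B B}

theorem mem_gradePiece_iff {d : ℤ} {x : B} :
    x ∈ gradePiece D U d ↔ D (U x) - U (D x) = (d : B) * x := by
  rw [gradePiece, LinearMap.mem_ker, ← zsmul_eq_mul, ← sub_eq_zero (b := d • x),
    ← Derivation.commutator_apply]
  rfl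

theorem map_mem_gradePiece_add_two (hD : ⁅D, ⁅D, U⁆⁆ = (-2 : ℤ) • D) {d : ℤ} {x : B}
    (hx : x ∈ gradePiece D U d) : D x ∈ gradePiece D U (d + 2) := by
  rw [mem_gradePiece_iff] at hx ⊢
  have h := DFunLike.congr_fun hD x
  simp only [Derivation.commutator_apply, hx] at h
  simp at h
  push_cast
  linear_combination -h

theorem map_mem_gradePiece_sub_two (hU : ⁅U, ⁅D, U⁆⁆ = (2 : ℤ) • U) {d : ℤ} {x : B}
    (hx : x ∈ gradePiece D U d) : U x ∈ gradePiece D U (d - 2) := by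
  rw [mem_gradePiece_iff] at hx ⊢
  have h := DFunLike.congr_fun hU x
  simp only [Derivation.commutator_apply, hx] at h
  simp at h
  push_cast
  linear_combination -h

theorem pow_mem_gradePiece_sub (hU : ⁅U, ⁅D, U⁆⁆ = (2 : ℤ) • U) {d : ℤ} {x : B}
    (hx : x ∈ gradePiece D U d) (m : ℕ) :
    (U.toLinearMap ^ m) x ∈ gradePiece D U (d - 2 * m) := by
  induction m with
  | zero => simpa using hx
  | succ m ih =>
    rw [pow_succ', Module.End.mul_apply]
    convert map_mem_gradePiece_sub_two hU ih using 2
    · push_cast; ring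
    · rfl

theorem pow_mem_gradePiece_add (hD : ⁅D, ⁅D, U⁆⁆ = (-2 : ℤ) • D) {d : ℤ} {x : B}
    (hx : x ∈ gradePiece D U d) (m : ℕ) :
    (D.toLinearMap ^ m) x ∈ gradePiece D U (d + 2 * m) := by
  induction m with
  | zero => simpa using hx
  | succ m ih =>
    rw [pow_succ', Module.End.mul_apply]
    convert map_mem_gradePiece_add_two hD ih using 2
    · push_cast; ring
    · rfl

/-- The `𝔰𝔩₂` commutation formula for powers of `U` acting on a vector killed by `D`. -/
theorem apply_pow_succ_of_apply_eq_zero (hU : ⁅U, ⁅D, U⁆⁆ = (2 : ℤ) • U) {d : ℤ} {x : B}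
    (hx : x ∈ gradePiece D U d) (hDx : D x = 0) (m : ℕ) :
    D ((U.toLinearMap ^ (m + 1)) x) =
      (((m + 1) * (d - m) : ℤ) : B) * (U.toLinearMap ^ m) x := by
  induction m with
  | zero =>
    have := mem_gradePiece_iff.1 hx
    simpa [hDx] using this
  | succ m ih =>
    have h := mem_gradePiece_iff.1 (pow_mem_gradePiece_sub hU hx (m + 1))
    rw [ih] at h
    rw [pow_succ' _ (m + 1), Module.End.mul_apply]
    have h2 : (U.toLinearMap ^ (m + 1)) x = U ((U.toLinearMap ^ m) x) := by
      rw [pow_succ', Module.End.mul_apply]; rfl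
    simp [← h2] at h ⊢
    linear_combination h

/-- The `𝔰𝔩₂` commutation formula for `U` and powers of `D` acting on a homogeneous element. -/
theorem pow_succ_apply_map (hD : ⁅D, ⁅D, U⁆⁆ = (-2 : ℤ) • D) {d : ℤ} {x : B}
    (hx : x ∈ gradePiece D U d) (r : ℕ) :
    (D.toLinearMap ^ (r + 1)) (U x) = U ((D.toLinearMap ^ (r + 1)) x) +
      (((r + 1) * (d + r) : ℤ) : B) * (D.toLinearMap ^ r) x := by
  induction r with
  | zero =>
    have := mem_gradePiece_iff.1 hx
    simp
    linear_combination this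
  | succ r ih =>
    have h := mem_gradePiece_iff.1 (pow_mem_gradePiece_add hD hx (r + 1))
    rw [pow_succ' _ (r + 1), Module.End.mul_apply, Module.End.mul_apply, ih]
    have h2 : (D.toLinearMap ^ (r + 1)) x = D ((D.toLinearMap ^ r) x) := by
      rw [pow_succ', Module.End.mul_apply]; rfl
    simp [← h2] at h ⊢
    linear_combination h

end FundamentalPair

section CharZero

variable {k B : Type*} [Field k] [CharZero k] [CommRing B] [Algebra k B] {D U : Derivation k B B}

theorem eq_zero_of_mem_gradePiece_of_apply_eq_zero [IsDomain B] (hnil : IsLND U)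
    (hU : ⁅U, ⁅D, U⁆⁆ = (2 : ℤ) • U) {n : ℤ} (hn : n ≤ -1) {x : B}
    (hx : x ∈ gradePiece D U n) (hDx : D x = 0) : x = 0 := by
  have : CharZero B := charZero_of_injective_algebraMap (algebraMap k B).injective
  obtain ⟨m, hm⟩ := hnil x
  induction m with
  | zero => simpa using hm
  | succ m ih =>
    have h := apply_pow_succ_of_apply_eq_zero hU hx hDx m
    rw [hm, map_zero] at h
    refine ih ((mul_eq_zero.1 h.symm).resolve_left ?_)
    exact Int.cast_ne_zero.2 (mul_ne_zero (by omega) (by omega))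

theorem exists_apply_eq_of_pow_apply_eq_zero (hD : ⁅D, ⁅D, U⁆⁆ = (-2 : ℤ) • D)
    (hU : ⁅U, ⁅D, U⁆⁆ = (2 : ℤ) • U) {n : ℤ} (hn : -1 ≤ n) (r : ℕ) {y : B}
    (hy : y ∈ gradePiece D U (n + 2)) (hr : (D.toLinearMap ^ r) y = 0) :
    ∃ x ∈ gradePiece D U n, D x = y := by
  induction r generalizing y with
  | zero => exact ⟨0, zero_mem _, by simpa using hr.symm⟩
  | succ r ih =>
    have hUy : U y ∈ gradePiece D U n := by simpa using map_mem_gradePiece_sub_two hU hy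
    set c : ℤ := (r + 1) * (n + 2 + r) with hc
    have hc0 : (c : k) ≠ 0 := Int.cast_ne_zero.2 (mul_ne_zero (by omega) (by omega))
    have key := pow_succ_apply_map hD hy r
    rw [hr, map_zero, zero_add, ← hc, pow_succ, Module.End.mul_apply] at key
    obtain ⟨x, hx, hDx⟩ := ih (y := D (U y) - (c : k) • y)
      (sub_mem (map_mem_gradePiece_add_two hD hUy) (Submodule.smul_mem _ _ hy)) (by
        rw [map_sub, map_smul, Algebra.smul_def, map_intCast]
        exact sub_eq_zero.2 key)
    refine ⟨(c : k)⁻¹ • (U y - x), Submodule.smul_mem _ _ (sub_mem hUy hx), ?_⟩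
    rw [Derivation.map_smul, map_sub, hDx, sub_sub_cancel, inv_smul_smul₀ hc0]

end CharZero

/-- for a nontrivial fundamental pair `(D,U)` on an affine `k`-domain `B`
with induced grading `B = ⊕ B_n`, the map `D : B_n → B_{n+2}` is injective for `n ≤ −1`
and surjective for `n ≥ −1`. -/
theorem stmt_8 {k B : Type*} [Field k] [CharZero k] [CommRing B] [IsDomain B] [Algebra k B]
    [Algebra.FiniteType k B]
    (D U : Derivation k B B) (hDU : IsFundamentalPair D U) (hnt : ¬(D = 0 ∧ U = 0))
    (n : ℤ) :
    (n ≤ -1 → ∀ x ∈ gradePiece D U n, D x = 0 → x = 0) ∧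
    (-1 ≤ n → ∀ y ∈ gradePiece D U (n + 2), ∃ x ∈ gradePiece D U n, D x = y) := by
  obtain ⟨hDnil, hUnil, hD, hU, -⟩ := hDU
  refine ⟨fun hn x hx hDx => eq_zero_of_mem_gradePiece_of_apply_eq_zero hUnil hU hn hx hDx,
    fun hn y hy => ?_⟩
  obtain ⟨r, hr⟩ := hDnil y
  exact exists_apply_eq_of_pow_apply_eq_zero hD hU hn r hy hr
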